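/- Let ⋆ be a semistar operation on an integral domain D with ⋆̃-dim(D) finite. If D is ⋆̃-locally Jaffard, i.e., the localization D_P is a Jaffard domain for every quasi-⋆̃-prime ideal P of D, then D is a ⋆̃-Jaffard domain, i.e., ⋆[n]-dim(D[X₁,…,Xₙ]) = ⋆̃-dim(D) + n for every n ≥ 1. -/

import Mathlib

/- ## Preliminaries: general ideal-chain notions in a commutative ring -/

open Pointwise

section ChainNotions

variable {A B : Type*} [CommRing A] [CommRing B]

/-- `P` and `Q` are adjacent with respect to the class `Φ` of ideals:
`P ⊂ Q` and no ideal of the class `Φ` lies strictly between them. -/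
def AdjacentFor (Φ : Ideal A → Prop) (P Q : Ideal A) : Prop :=
  P < Q ∧ ∀ I : Ideal A, Φ I → ¬(P < I ∧ I < Q)

/-- A saturated chain, consisting of ideals of the class `Φ`, of length `m`
between `P` and `Q` (saturated: consecutive members are `Φ`-adjacent). -/
def SaturatedChainFor (Φ : Ideal A → Prop) (P Q : Ideal A) (m : ℕ) : Prop :=
  ∃ c : Fin (m + 1) → Ideal A, StrictMono c ∧ c 0 = P ∧ c (Fin.last m) = Q ∧
    (∀ i, Φ (c i)) ∧ ∀ i : Fin m, AdjacentFor Φ (c i.castSucc) (c i.succ)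

/-- Catenarity with respect to the class `Φ` of ideals: for every pair `P ⊂ Q` of
`Φ`-ideals, any two saturated chains of `Φ`-ideals between `P` and `Q` have the
same (finite) length. -/
def CatenaryFor (Φ : Ideal A → Prop) : Prop :=
  ∀ P Q : Ideal A, Φ P → Φ Q → P < Q →
    ∀ m₁ m₂ : ℕ, SaturatedChainFor Φ P Q m₁ → SaturatedChainFor Φ P Q m₂ → m₁ = m₂

/-- A chain `(0) = P₀ ⊂ P₁ ⊂ ⋯ ⊂ Pₙ` with all `Pᵢ`, `1 ≤ i ≤ n`, in the class `Φ`. -/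
def DimChainFor (Φ : Ideal A → Prop) (n : ℕ) : Prop :=
  ∃ c : Fin (n + 1) → Ideal A, StrictMono c ∧ c 0 = ⊥ ∧ ∀ i, i ≠ 0 → Φ (c i)

/-- The dimension associated to the class `Φ` of (quasi-prime) ideals: the supremum of
the lengths of chains `(0) = P₀ ⊂ P₁ ⊂ ⋯ ⊂ Pₙ` with all `Pᵢ` (`i ≥ 1`) in `Φ`. -/
noncomputable def quasiDim (Φ : Ideal A → Prop) : ℕ∞ :=
  ⨆ (n : ℕ) (_ : DimChainFor Φ n), (n : ℕ∞)

/-- The height of an ideal `P`: the supremum of lengths of strict chains of prime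
ideals ending at `P`. -/
noncomputable def idealHeight (P : Ideal A) : ℕ∞ :=
  ⨆ (n : ℕ) (_ : ∃ c : Fin (n + 1) → Ideal A, StrictMono c ∧ (∀ i, (c i).IsPrime) ∧
      c (Fin.last n) = P), (n : ℕ∞)

/-- The Krull dimension of a commutative ring, as the supremum in `ℕ∞` of the lengths
of strict chains of prime ideals. -/
noncomputable def krullDimE (A : Type*) [CommRing A] : ℕ∞ :=
  ⨆ (n : ℕ) (_ : ∃ c : Fin (n + 1) → Ideal A, StrictMono c ∧ ∀ i, (c i).IsPrime), (n : ℕ∞)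

/-- Every pair of `Φ`-adjacent `Φ`-ideals `P ⊂ Q` of `A` extends, along `f : A →+* B`,
to a pair of `Ψ`-adjacent `Ψ`-ideals `P.map f ⊂ Q.map f` of `B`. -/
def ExtendsAdjacent (f : A →+* B) (Φ : Ideal A → Prop) (Ψ : Ideal B → Prop) : Prop :=
  ∀ P Q : Ideal A, Φ P → Φ Q → AdjacentFor Φ P Q →
    Ψ (Ideal.map f P) ∧ Ψ (Ideal.map f Q) ∧ AdjacentFor Ψ (Ideal.map f P) (Ideal.map f Q)

/-- A (classically) catenary ring: any two saturated chains of primes between a fixed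
pair of primes `P ⊂ Q` have the same finite length. -/
def IsCatenaryRing (A : Type*) [CommRing A] : Prop :=
  CatenaryFor (fun I : Ideal A => I.IsPrime)

/-- A (classical) S-domain: every height-one prime `P` extends to a height-one prime
`P[X]` of the polynomial ring. -/
def IsSDomain (A : Type*) [CommRing A] : Prop :=
  ∀ P : Ideal A, P.IsPrime → idealHeight P = 1 →
    idealHeight (Ideal.map (Polynomial.C : A →+* Polynomial A) P) = 1

/-- A (classical) strong S-domain: every pair of adjacent primes `P ⊂ Q` extends to a
pair of adjacent primes `P[X] ⊂ Q[X]` of the polynomial ring. -/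
def IsStrongSDomain (A : Type*) [CommRing A] : Prop :=
  ExtendsAdjacent (Polynomial.C : A →+* Polynomial A)
    (fun I : Ideal A => I.IsPrime) (fun I : Ideal (Polynomial A) => I.IsPrime)

/-- A (classical) stably strong S-domain: `A[X₁,…,Xₙ]` is a strong S-domain for all `n ≥ 1`. -/
def IsStablyStrongSDomain (A : Type*) [CommRing A] : Prop :=
  ∀ n : ℕ, 1 ≤ n → IsStrongSDomain (MvPolynomial (Fin n) A)

/-- A (classical) Jaffard domain: finite Krull dimension, and
`dim (A[X₁,…,Xₙ]) = dim A + n` for all `n ≥ 1`. -/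
def IsJaffardDomain (A : Type*) [CommRing A] : Prop :=
  krullDimE A ≠ ⊤ ∧ ∀ n : ℕ, 1 ≤ n → krullDimE (MvPolynomial (Fin n) A) = krullDimE A + n

end ChainNotions

/- ## Semistar operations -/

section Semistar

variable (R : Type*) (F : Type*) [CommRing R] [Field F] [Algebra R F]

instance (priority := 100) : SMulCommClass F R F := SMulCommClass.symm R F F

/-- A semistar operation on a domain `R` with quotient field `F`: an operation on the
(nonzero) `R`-submodules of `F` satisfying `(xE)^⋆ = x E^⋆`, monotonicity, extensivity
and idempotency. (The value on the zero submodule is irrelevant.) -/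
structure SemistarOp where
  /-- the underlying map on `R`-submodules of `F` -/
  star : Submodule R F → Submodule R F
  star_smul : ∀ x : F, x ≠ 0 → ∀ E : Submodule R F, E ≠ ⊥ → star (x • E) = x • star E
  star_mono : ∀ E G : Submodule R F, E ≠ ⊥ → G ≠ ⊥ → E ≤ G → star E ≤ star G
  le_star : ∀ E : Submodule R F, E ≠ ⊥ → E ≤ star E
  star_idem : ∀ E : Submodule R F, E ≠ ⊥ → star (star E) = star E

variable {R F}

/-- The extension of an ideal of `R` to an `R`-submodule of `F`. -/
def idealExt (I : Ideal R) : Submodule R F := Submodule.map (Algebra.linearMap R F) I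

/-- The contraction to `R` of an `R`-submodule of `F` (i.e. `E ∩ R`). -/
def idealCon (E : Submodule R F) : Ideal R := Submodule.comap (Algebra.linearMap R F) E

/-- The finite-type semistar operation `⋆_f` associated to `⋆`:
`E^{⋆_f}` is the union of `G^⋆` over all nonzero finitely generated `G ⊆ E`
(the family is directed, so the union is the supremum). -/
noncomputable def SemistarOp.ft (s : SemistarOp R F) (E : Submodule R F) : Submodule R F :=
  ⨆ (G : Submodule R F) (_ : G.FG ∧ G ≠ ⊥ ∧ G ≤ E), s.star G

/-- `I` is a quasi-`f`-ideal (for `f` a semistar-type operation, e.g. `s.star`, `s.ft`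
or `s.tilde`): `I` is nonzero and `f(I) ∩ R = I`. -/
def IsQuasiIdeal (f : Submodule R F → Submodule R F) (I : Ideal R) : Prop :=
  I ≠ ⊥ ∧ idealCon (f (idealExt I)) = I

/-- A quasi-prime: a prime quasi-ideal. -/
def IsQuasiPrime (f : Submodule R F → Submodule R F) (I : Ideal R) : Prop :=
  I.IsPrime ∧ IsQuasiIdeal f I

/-- A quasi-maximal ideal: maximal among proper quasi-ideals. -/
def IsQuasiMax (f : Submodule R F → Submodule R F) (I : Ideal R) : Prop :=
  IsQuasiIdeal f I ∧ I ≠ ⊤ ∧ ∀ J : Ideal R, IsQuasiIdeal f J → J ≠ ⊤ → I ≤ J → I = J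

/-- The stable finite-type semistar operation `⋆̃` associated to `⋆`:
`E^{⋆̃} = ⋂ { E R_P : P a quasi-⋆_f-maximal ideal }`, where
`x ∈ E R_P ↔ ∃ d ∉ P, d • x ∈ E` (each quasi-⋆_f-maximal ideal is prime); if there
is no quasi-⋆_f-maximal ideal, `E^{⋆̃} = F`. -/
def SemistarOp.tilde (s : SemistarOp R F) (E : Submodule R F) : Submodule R F where
  carrier := {x : F | ∀ P : Ideal R, IsQuasiMax s.ft P → P.IsPrime →
    ∃ d : R, d ∉ P ∧ d • x ∈ E}
  zero_mem' := by
    intro P _ hP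
    exact ⟨1, fun h => hP.ne_top ((Ideal.eq_top_iff_one P).mpr h), by simp⟩
  add_mem' := by
    intro x y hx hy P hPmax hP
    obtain ⟨d₁, hd₁, hdx⟩ := hx P hPmax hP
    obtain ⟨d₂, hd₂, hdy⟩ := hy P hPmax hP
    refine ⟨d₁ * d₂, fun h => (hP.mem_or_mem h).elim hd₁ hd₂, ?_⟩
    have h₁ : (d₁ * d₂) • x ∈ E := by rw [mul_comm, mul_smul]; exact E.smul_mem d₂ hdx
    have h₂ : (d₁ * d₂) • y ∈ E := by rw [mul_smul]; exact E.smul_mem d₁ hdy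
    simpa [smul_add] using E.add_mem h₁ h₂
  smul_mem' := by
    intro r x hx P hPmax hP
    obtain ⟨d, hd, hdx⟩ := hx P hPmax hP
    refine ⟨d, hd, ?_⟩
    rw [smul_smul, mul_comm, ← smul_smul]
    exact E.smul_mem r hdx

/-- The characterization of the quasi-`⋆[n]`-prime ideals of `R[n] = R[X₁,…,Xₙ]` for the
iterated Nagata-type (stable, finite-type) semistar operation `⋆[n]` on `R[n]`:
a nonzero prime `Q` of `R[n]` is quasi-`⋆[n]`-prime iff `Q ∩ R = 0` or
`(Q ∩ R)^{⋆_f} ≠ R^⋆`. -/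
def QuasiPolyPrime (s : SemistarOp R F) (n : ℕ) (Q : Ideal (MvPolynomial (Fin n) R)) : Prop :=
  Q ≠ ⊥ ∧ Q.IsPrime ∧
    (Ideal.comap (algebraMap R (MvPolynomial (Fin n) R)) Q = ⊥ ∨
      s.ft (idealExt (Ideal.comap (algebraMap R (MvPolynomial (Fin n) R)) Q)) ≠
        s.star (idealExt (⊤ : Ideal R)))

/-- The `⋆̃`-dimension of `R`. -/
noncomputable def tildeDim (s : SemistarOp R F) : ℕ∞ := quasiDim (IsQuasiPrime s.tilde)

/-- The `⋆[n]`-dimension of `R[n] = R[X₁,…,Xₙ]`. -/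
noncomputable def polyDim (s : SemistarOp R F) (n : ℕ) : ℕ∞ := quasiDim (QuasiPolyPrime s n)

/-- `R` is a `⋆̃`-S-domain: every height-one quasi-`⋆̃`-prime `P` extends to a height-one
quasi-`⋆[1]`-prime `P[X₁]` of `R[X₁]`. -/
def TildeSDomain (s : SemistarOp R F) : Prop :=
  ∀ P : Ideal R, IsQuasiPrime s.tilde P → idealHeight P = 1 →
    QuasiPolyPrime s 1 (Ideal.map (algebraMap R (MvPolynomial (Fin 1) R)) P) ∧
    idealHeight (Ideal.map (algebraMap R (MvPolynomial (Fin 1) R)) P) = 1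

/-- `R` is a `⋆̃`-strong S-domain: each pair of adjacent quasi-`⋆̃`-primes `P₁ ⊂ P₂`
extends to a pair of adjacent quasi-`⋆[1]`-primes `P₁[X₁] ⊂ P₂[X₁]` of `R[X₁]`. -/
def TildeStrongSDomain (s : SemistarOp R F) : Prop :=
  ExtendsAdjacent (algebraMap R (MvPolynomial (Fin 1) R))
    (IsQuasiPrime s.tilde) (QuasiPolyPrime s 1)

/-- `R[n]` is a `⋆[n]`-strong S-domain: each pair of adjacent quasi-`⋆[n]`-primes
`Q₁ ⊂ Q₂` of `R[n]` extends to a pair of adjacent quasi-`⋆[n+1]`-primes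
`Q₁[X_{n+1}] ⊂ Q₂[X_{n+1}]` of `R[n+1]`. -/
def PolyStrongSDomain (s : SemistarOp R F) (n : ℕ) : Prop :=
  ExtendsAdjacent (MvPolynomial.rename (Fin.castSucc : Fin n → Fin (n + 1))).toRingHom
    (QuasiPolyPrime s n) (QuasiPolyPrime s (n + 1))

/-- `R` is a `⋆̃`-stably strong S-domain: `R[n]` is a `⋆[n]`-strong S-domain for all
`n ≥ 1`. -/
def TildeStablyStrongSDomain (s : SemistarOp R F) : Prop :=
  ∀ n : ℕ, 1 ≤ n → PolyStrongSDomain s n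

/-- `R` is `⋆̃`-catenary. -/
def TildeCatenary (s : SemistarOp R F) : Prop := CatenaryFor (IsQuasiPrime s.tilde)

/-- `R[n]` is `⋆[n]`-catenary. -/
def PolyCatenary (s : SemistarOp R F) (n : ℕ) : Prop := CatenaryFor (QuasiPolyPrime s n)

/-- `R` is `⋆̃`-universally catenarian: `R[n]` is `⋆[n]`-catenary for all `n ≥ 1`. -/
def TildeUnivCatenarian (s : SemistarOp R F) : Prop :=
  ∀ n : ℕ, 1 ≤ n → PolyCatenary s n

/-- `R` is a `⋆̃`-Jaffard domain. -/
def TildeJaffard (s : SemistarOp R F) : Prop :=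
  tildeDim s ≠ ⊤ ∧ ∀ n : ℕ, 1 ≤ n → polyDim s n = tildeDim s + n

/-- `R` is `⋆̃`-Noetherian: ascending chain condition on quasi-`⋆̃`-ideals. -/
def TildeNoetherian (s : SemistarOp R F) : Prop :=
  ∀ f : ℕ → Ideal R, (∀ i, IsQuasiIdeal s.tilde (f i)) → Monotone f →
    ∃ N : ℕ, ∀ m : ℕ, N ≤ m → f m = f N

/-- `R` is a `⋆̃`-quasi-Prüfer domain: every prime `Q` of `R[X]` with `Q ⊆ P[X]` for some
quasi-`⋆̃`-prime `P` of `R` satisfies `Q = (Q ∩ R)[X]`. -/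
def TildeQuasiPrufer (s : SemistarOp R F) : Prop :=
  ∀ Q : Ideal (Polynomial R), Q.IsPrime →
    (∃ P : Ideal R, IsQuasiPrime s.tilde P ∧
      Q ≤ Ideal.map (Polynomial.C : R →+* Polynomial R) P) →
    Q = Ideal.map (Polynomial.C : R →+* Polynomial R)
      (Ideal.comap (Polynomial.C : R →+* Polynomial R) Q)

/-- `R` is a Prüfer `⋆`-multiplication domain: `(I · (R :_F I))^{⋆_f} = R^⋆` for every
nonzero finitely generated ideal `I` of `R`. -/
def IsPStarMD (s : SemistarOp R F) : Prop :=
  ∀ I : Ideal R, I ≠ ⊥ → I.FG →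
    s.ft (idealExt I * ((idealExt (⊤ : Ideal R) : Submodule R F) / idealExt I)) =
      s.star (idealExt (⊤ : Ideal R))

/-- An overring `T` of `R` (with semistar operation `⋆'`) is `(⋆,⋆')`-linked to `R`:
for every nonzero finitely generated ideal `G` of `R`, `G^⋆ = R^⋆` implies
`(GT)^{⋆'} = T^{⋆'}`. -/
def IsLinkedOverring (s : SemistarOp R F) (T : Subalgebra R F) (s' : SemistarOp T F) : Prop :=
  ∀ G : Ideal R, G ≠ ⊥ → G.FG →
    s.star (idealExt G) = s.star (idealExt (⊤ : Ideal R)) →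
      s'.star (idealExt (Ideal.map (algebraMap R T) G)) =
        s'.star (idealExt (⊤ : Ideal T))

/-- `R` is a `⋆̃`-going-down domain: for every overring `T` of `R` (a subring of `F`
containing `R`; note `F` is also the quotient field of `T`) and every semistar operation
`⋆'` on `T`, the extension `R ⊆ T` satisfies `(⋆̃,⋆̃')`-GD. -/
def TildeGoingDown (s : SemistarOp R F) : Prop :=
  ∀ (T : Subalgebra R F) (s' : SemistarOp T F),
    ∀ P₀ P : Ideal R, IsQuasiPrime s.tilde P₀ → IsQuasiPrime s.tilde P → P₀ < P →
      ∀ Q : Ideal T, IsQuasiPrime s'.tilde Q → Ideal.comap (algebraMap R T) Q = P →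
        ∃ Q₀ : Ideal T, IsQuasiPrime s'.tilde Q₀ ∧ Q₀ ≤ Q ∧
          Ideal.comap (algebraMap R T) Q₀ = P₀

end Semistar
section FiniteType

variable {R F : Type*} [CommRing R] [Field F] [Algebra R F]

theorem Submodule.FG.exists_le_of_le_iSup_of_directed {M ι : Type*} [AddCommGroup M] [Module R M]
    [Nonempty ι] {G : Submodule R M} (hG : G.FG) {S : ι → Submodule R M}
    (hS : Directed (· ≤ ·) S) (h : G ≤ iSup S) : ∃ i, G ≤ S i := by
  obtain ⟨_, ⟨i, rfl⟩, hi⟩ := (Submodule.fg_iff_compact G).1 hG (Set.range S) _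
    (Set.range_nonempty S) hS.directedOn_range (isLUB_iSup (f := S)) h
  exact ⟨i, hi⟩

theorem idealExt_ne_bot [FaithfulSMul R F] {I : Ideal R} (hI : I ≠ ⊥) :
    (idealExt I : Submodule R F) ≠ ⊥ := by
  obtain ⟨x, hx, hx0⟩ := Submodule.exists_mem_ne_zero_of_ne_bot hI
  exact (Submodule.ne_bot_iff _).2 ⟨_, ⟨x, hx, rfl⟩, by simpa using hx0⟩

theorem mem_idealCon {E : Submodule R F} {x : R} : x ∈ idealCon E ↔ algebraMap R F x ∈ E :=
  Iff.rfl

theorem algebraMap_mem_idealExt {I : Ideal R} {x : R} (hx : x ∈ I) :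
    algebraMap R F x ∈ (idealExt I : Submodule R F) :=
  ⟨x, hx, rfl⟩

theorem idealExt_mono {I J : Ideal R} (h : I ≤ J) : (idealExt I : Submodule R F) ≤ idealExt J :=
  Submodule.map_mono h

theorem idealExt_idealCon_le (E : Submodule R F) : idealExt (idealCon E) ≤ E :=
  Submodule.map_comap_le _ _

namespace SemistarOp

variable (s : SemistarOp R F)

theorem star_le_ft {E G : Submodule R F} (hG : G.FG) (hG0 : G ≠ ⊥) (hGE : G ≤ E) :
    s.star G ≤ s.ft E :=
  le_iSup₂_of_le G ⟨hG, hG0, hGE⟩ le_rfl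

theorem ft_mono {E E' : Submodule R F} (h : E ≤ E') : s.ft E ≤ s.ft E' :=
  iSup₂_le fun _ hG => s.star_le_ft hG.1 hG.2.1 (hG.2.2.trans h)

theorem le_ft (E : Submodule R F) : E ≤ s.ft E := by
  intro x hx
  by_cases hx0 : x = 0
  · exact hx0 ▸ zero_mem _
  have h0 : Submodule.span R {x} ≠ ⊥ := by simpa using hx0
  exact s.star_le_ft (Submodule.fg_span_singleton x) h0
    (by simpa using hx) (s.le_star _ h0 (Submodule.mem_span_singleton_self x))

theorem exists_le_star_of_le_ft {E G : Submodule R F} (hE : E ≠ ⊥) (hG : G.FG)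
    (h : G ≤ s.ft E) : ∃ H : Submodule R F, H.FG ∧ H ≠ ⊥ ∧ H ≤ E ∧ G ≤ s.star H := by
  let ι := {H : Submodule R F // H.FG ∧ H ≠ ⊥ ∧ H ≤ E}
  obtain ⟨x, hx, hx0⟩ := E.exists_mem_ne_zero_of_ne_bot hE
  have : Nonempty ι :=
    ⟨Submodule.span R {x}, Submodule.fg_span_singleton x, by simpa using hx0, by simpa using hx⟩
  have hdir : Directed (· ≤ ·) fun H : ι => s.star H.1 := by
    intro H K
    have h0 : H.1 ⊔ K.1 ≠ ⊥ := ne_bot_of_le_ne_bot H.2.2.1 le_sup_left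
    exact ⟨⟨H.1 ⊔ K.1, H.2.1.sup K.2.1, h0, sup_le H.2.2.2 K.2.2.2⟩,
      s.star_mono _ _ H.2.2.1 h0 le_sup_left, s.star_mono _ _ K.2.2.1 h0 le_sup_right⟩
  have hft : s.ft E = ⨆ H : ι, s.star H.1 := iSup_subtype'
  obtain ⟨H, hH⟩ := hG.exists_le_of_le_iSup_of_directed hdir (hft ▸ h)
  exact ⟨H.1, H.2.1, H.2.2.1, H.2.2.2, hH⟩

theorem mem_ft {E : Submodule R F} (hE : E ≠ ⊥) {x : F} :
    x ∈ s.ft E ↔ ∃ H : Submodule R F, H.FG ∧ H ≠ ⊥ ∧ H ≤ E ∧ x ∈ s.star H := by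
  constructor
  · intro hx
    obtain ⟨H, h₁, h₂, h₃, h₄⟩ := s.exists_le_star_of_le_ft hE
      (Submodule.fg_span_singleton x) (by simpa using hx)
    exact ⟨H, h₁, h₂, h₃, by simpa using h₄⟩
  · rintro ⟨H, h₁, h₂, h₃, h₄⟩
    exact s.star_le_ft h₁ h₂ h₃ h₄

theorem ft_ft_le {E : Submodule R F} (hE : E ≠ ⊥) : s.ft (s.ft E) ≤ s.ft E := by
  refine iSup₂_le fun G hG => ?_
  obtain ⟨H, h₁, h₂, h₃, h₄⟩ := s.exists_le_star_of_le_ft hE hG.1 hG.2.2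
  have hstar : s.star H ≠ ⊥ := ne_bot_of_le_ne_bot h₂ (s.le_star H h₂)
  calc s.star G ≤ s.star (s.star H) := s.star_mono _ _ hG.2.1 hstar h₄
    _ = s.star H := s.star_idem H h₂
    _ ≤ s.ft E := s.star_le_ft h₁ h₂ h₃

theorem smul_mem_ft {E E' : Submodule R F} (hE : E ≠ ⊥) {x y : F} (hx : x ≠ 0)
    (h : x • E ≤ E') (hy : y ∈ s.ft E) : x * y ∈ s.ft E' := by
  obtain ⟨H, h₁, h₂, h₃, h₄⟩ := (s.mem_ft hE).1 hy
  have hmem : x * y ∈ s.star (x • H) := by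
    rw [s.star_smul x hx H h₂]
    exact Submodule.smul_mem_pointwise_smul y x _ h₄
  refine s.star_le_ft (h₁.map _) ?_ (le_trans ?_ h) hmem
  · obtain ⟨z, hz, hz0⟩ := H.exists_mem_ne_zero_of_ne_bot h₂
    exact (Submodule.ne_bot_iff _).2
      ⟨x * z, Submodule.smul_mem_pointwise_smul z x _ hz, mul_ne_zero hx hz0⟩
  · exact Submodule.map_mono h₃

theorem one_notMem_ft_iff {I : Ideal R} [FaithfulSMul R F] (hI : I ≠ ⊥) :
    (1 : F) ∉ s.ft (idealExt I) ↔ s.ft (idealExt I) ≠ s.star (idealExt (⊤ : Ideal R)) := by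
  have htop : (idealExt (⊤ : Ideal R) : Submodule R F) ≠ ⊥ :=
    ne_bot_of_le_ne_bot (idealExt_ne_bot hI) (idealExt_mono le_top)
  rw [not_iff_not]
  constructor
  · intro h
    refine le_antisymm (iSup₂_le fun G hG =>
      s.star_mono _ _ hG.2.1 htop (hG.2.2.trans (idealExt_mono le_top))) ?_
    obtain ⟨H, h₁, h₂, h₃, h₄⟩ := (s.mem_ft (idealExt_ne_bot hI)).1 h
    have hstar : s.star H ≠ ⊥ := ne_bot_of_le_ne_bot h₂ (s.le_star H h₂)
    refine le_trans ?_ (s.star_le_ft h₁ h₂ h₃)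
    rw [← s.star_idem H h₂]
    refine s.star_mono _ _ htop hstar ?_
    rintro _ ⟨r, -, rfl⟩
    simpa [Algebra.smul_def] using (s.star H).smul_mem r h₄
  · intro h
    rw [h]
    exact s.le_star _ htop ⟨1, Submodule.mem_top, map_one (algebraMap R F)⟩

variable [FaithfulSMul R F]

theorem isQuasiIdeal_ft_idealCon {I : Ideal R} (hI : I ≠ ⊥) :
    IsQuasiIdeal s.ft (idealCon (s.ft (idealExt I))) := by
  have hle : I ≤ idealCon (s.ft (idealExt I)) := fun x hx =>
    s.le_ft _ (algebraMap_mem_idealExt hx)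
  refine ⟨ne_bot_of_le_ne_bot hI hle, le_antisymm (fun x hx => ?_) fun x hx =>
    s.le_ft _ (algebraMap_mem_idealExt hx)⟩
  exact s.ft_ft_le (idealExt_ne_bot hI) (s.ft_mono (idealExt_idealCon_le _) hx)

theorem exists_isQuasiMax_ge {I : Ideal R} (hI : I ≠ ⊥) (h : (1 : F) ∉ s.ft (idealExt I)) :
    ∃ M : Ideal R, IsQuasiMax s.ft M ∧ I ≤ M := by
  obtain ⟨M, hIM, hM⟩ := zorn_le_nonempty₀ {J : Ideal R | I ≤ J ∧ (1 : F) ∉ s.ft (idealExt J)}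
    (fun c hc hchain J hJ => by
      refine ⟨sSup c, ⟨(hc hJ).1.trans (le_sSup hJ), fun hone => ?_⟩, fun K hK => le_sSup hK⟩
      have hne : ∀ K ∈ c, (idealExt K : Submodule R F) ≠ ⊥ := fun K hK =>
        idealExt_ne_bot (ne_bot_of_le_ne_bot hI (hc hK).1)
      have : Nonempty c := ⟨⟨J, hJ⟩⟩
      obtain ⟨H, h₁, h₂, h₃, h₄⟩ := (s.mem_ft (ne_bot_of_le_ne_bot (hne J hJ)
        (idealExt_mono (le_sSup hJ)))).1 hone
      have hdir : Directed (· ≤ ·) fun K : c => (idealExt K.1 : Submodule R F) :=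
        hchain.directedOn.directed_val.mono_comp _ fun _ _ => idealExt_mono
      rw [idealExt, sSup_eq_iSup', Submodule.map_iSup] at h₃
      obtain ⟨K, hK⟩ := h₁.exists_le_of_le_iSup_of_directed hdir h₃
      exact (hc K.2).2 (s.star_le_ft h₁ h₂ hK h₄)) I ⟨le_rfl, h⟩
  have hM0 : M ≠ ⊥ := ne_bot_of_le_ne_bot hI hIM
  have hMtop : ∀ J : Ideal R, IsQuasiIdeal s.ft J → J ≠ ⊤ → M ≤ J → M = J := by
    intro J hJ hJtop hMJ
    refine hM.eq_of_le ⟨hIM.trans hMJ, fun hone => hJtop ?_⟩ hMJ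
    rw [Ideal.eq_top_iff_one, ← hJ.2, mem_idealCon, map_one]
    exact hone
  have hcl : idealCon (s.ft (idealExt M)) ≠ ⊤ := by
    rw [Ne, Ideal.eq_top_iff_one, mem_idealCon, map_one]
    exact hM.prop.2
  have hquasi := s.isQuasiIdeal_ft_idealCon hM0
  have hMcl := hMtop _ hquasi hcl fun x hx => s.le_ft _ (algebraMap_mem_idealExt hx)
  exact ⟨M, ⟨hMcl ▸ hquasi, hMcl ▸ hcl, hMtop⟩, hIM⟩

theorem isPrime_of_isQuasiMax {M : Ideal R} (hM : IsQuasiMax s.ft M) : M.IsPrime := by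
  refine ⟨hM.2.1, fun {a b} hab => or_iff_not_imp_left.2 fun ha => ?_⟩
  by_cases hb : b = 0
  · exact hb ▸ zero_mem _
  set J := M ⊔ Ideal.span {a}
  have hJ0 : J ≠ ⊥ := ne_bot_of_le_ne_bot hM.1.1 le_sup_left
  have hJcl : J ≤ idealCon (s.ft (idealExt J)) := fun x hx =>
    s.le_ft _ (algebraMap_mem_idealExt hx)
  have hone : (1 : F) ∈ s.ft (idealExt J) := by
    by_contra hone
    have htop : idealCon (s.ft (idealExt J)) ≠ ⊤ := by
      rwa [Ne, Ideal.eq_top_iff_one, mem_idealCon, map_one]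
    have := hM.2.2 _ (s.isQuasiIdeal_ft_idealCon hJ0) htop (le_sup_left.trans hJcl)
    exact ha (this ▸ hJcl (Ideal.mem_sup_right (Ideal.mem_span_singleton_self a)))
  have hbF : algebraMap R F b ≠ 0 := by simpa using hb
  rw [← hM.1.2, mem_idealCon, ← mul_one (algebraMap R F b)]
  refine s.smul_mem_ft (idealExt_ne_bot hJ0) hbF ?_ hone
  rintro _ ⟨_, ⟨r, hr, rfl⟩, rfl⟩
  obtain ⟨m, hm, _, hc, rfl⟩ := Submodule.mem_sup.1 hr
  obtain ⟨c, rfl⟩ := Ideal.mem_span_singleton'.1 hc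
  refine ⟨b * (m + c * a), ?_, by simp⟩
  rw [mul_add]
  exact M.add_mem (M.mul_mem_left _ hm) (by
    rw [show b * (c * a) = c * (a * b) by ring]; exact M.mul_mem_left _ hab)

theorem isQuasiPrime_tilde_iff {P : Ideal R} [P.IsPrime] (hP : P ≠ ⊥) :
    IsQuasiPrime s.tilde P ↔
      s.ft (idealExt P) ≠ s.star (idealExt (⊤ : Ideal R)) := by
  have hprime : P.IsPrime := ‹_›
  rw [← s.one_notMem_ft_iff hP]
  constructor
  · rintro ⟨-, -, hquasi⟩ hone
    refine hprime.ne_top (P.eq_top_iff_one.2 ?_)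
    rw [← hquasi, mem_idealCon, map_one]
    intro M hM _
    obtain ⟨d, hdP, hdM⟩ : ∃ d ∈ P, d ∉ M := by
      by_contra! hPM
      refine hM.2.1 (M.eq_top_iff_one.2 ?_)
      rw [← hM.1.2, mem_idealCon, map_one]
      exact s.ft_mono (idealExt_mono hPM) hone
    exact ⟨d, hdM, by simpa [Algebra.smul_def] using algebraMap_mem_idealExt (F := F) hdP⟩
  · intro h
    obtain ⟨M, hM, hPM⟩ := s.exists_isQuasiMax_ge hP h
    refine ⟨hprime, hP, le_antisymm (fun x hx => ?_) fun x hx N _ hN =>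
      ⟨1, fun h1 => hN.ne_top (N.eq_top_iff_one.2 h1), by
        simpa using algebraMap_mem_idealExt hx⟩⟩
    obtain ⟨d, hd, y, hy, hyx⟩ := hx M hM (s.isPrime_of_isQuasiMax hM)
    have : y = d * x := FaithfulSMul.algebraMap_injective R F (by
      simpa [Algebra.smul_def] using hyx)
    exact (hprime.mem_or_mem (this ▸ hy : d * x ∈ P)).resolve_left fun hdP => hd (hPM hdP)

end SemistarOp

end FiniteType

section Dimension

variable {A B : Type*} [CommRing A] [CommRing B]

theorem coe_krullDimE [Nontrivial A] : (krullDimE A : WithBot ℕ∞) = ringKrullDim A := by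
  apply le_antisymm
  · obtain ⟨d, hd⟩ := WithBot.ne_bot_iff_exists.1 
      (bot_lt_iff_ne_bot.1 ((WithBot.bot_lt_coe 0).trans_le
        (ringKrullDim_nonneg_of_nontrivial (R := A))))
    rw [← hd, WithBot.coe_le_coe]
    refine iSup₂_le fun n ⟨c, hc, hprime⟩ => ?_
    rw [← WithBot.coe_le_coe, hd]
    exact Order.le_krullDim_iff.2 ⟨⟨n, fun i => ⟨c i, hprime i⟩, fun i => hc i.castSucc_lt_succ⟩, rfl⟩
  · refine iSup_le fun l => WithBot.coe_le_coe.2 ?_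
    exact le_iSup₂_of_le l.length
      ⟨fun i => (l i).asIdeal, fun i j hij => l.strictMono hij, fun i => (l i).isPrime⟩ le_rfl

theorem krullDimE_mvPolynomial_of_isNoetherianRing [IsNoetherianRing A] [Nontrivial A] (n : ℕ) :
    krullDimE (MvPolynomial (Fin n) A) = krullDimE A + n := by
  rw [← WithBot.coe_inj, WithBot.coe_add, coe_krullDimE, coe_krullDimE,
    MvPolynomial.ringKrullDim_of_isNoetherianRing]
  simp

theorem DimChainFor.of_isPrime_chain {Φ : Ideal B → Prop} {n : ℕ} {c : Fin (n + 1) → Ideal B}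
    (hc : StrictMono c) (hΦ : ∀ i, c i ≠ ⊥ → Φ (c i)) : DimChainFor Φ n := by
  refine ⟨Function.update c 0 ⊥, ?_, Function.update_self .., fun i hi => ?_⟩
  · intro i j hij
    have hj : j ≠ 0 := (Fin.zero_le i |>.trans_lt hij).ne'
    rw [Function.update_of_ne hj]
    by_cases hi : i = 0
    · subst hi
      simpa using bot_le.trans_lt (hc hij)
    · rw [Function.update_of_ne hi]
      exact hc hij
  · rw [Function.update_of_ne hi]
    exact hΦ i (bot_le.trans_lt (hc (Fin.pos_iff_ne_zero.2 hi))).ne'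

theorem exists_isPrime_chain_localization_iff {S : Type*} [CommRing S] [Algebra B S]
    (M : Submonoid B) [IsLocalization M S] (n : ℕ) :
    (∃ c : Fin (n + 1) → Ideal S, StrictMono c ∧ ∀ i, (c i).IsPrime) ↔
      ∃ c : Fin (n + 1) → Ideal B, StrictMono c ∧
        ∀ i, (c i).IsPrime ∧ Disjoint (M : Set B) (c i) := by
  let e := IsLocalization.orderIsoOfPrime M S
  constructor
  · rintro ⟨c, hc, hp⟩
    exact ⟨fun i => e ⟨c i, hp i⟩, fun i j hij => e.strictMono (hc hij),
      fun i => (e ⟨c i, hp i⟩).2⟩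
  · rintro ⟨c, hc, hp⟩
    exact ⟨fun i => e.symm ⟨c i, hp i⟩, fun i j hij => e.symm.strictMono (hc hij),
      fun i => (e.symm ⟨c i, hp i⟩).2⟩

theorem exists_isPrime_chain_atPrime_iff (P : Ideal A) [P.IsPrime] (n : ℕ) :
    (∃ c : Fin (n + 1) → Ideal (Localization.AtPrime P), StrictMono c ∧ ∀ i, (c i).IsPrime) ↔
      ∃ c : Fin (n + 1) → Ideal A, StrictMono c ∧ ∀ i, (c i).IsPrime ∧ c i ≤ P := by
  rw [exists_isPrime_chain_localization_iff P.primeCompl]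
  simp only [Ideal.primeCompl, Submonoid.coe_set_mk, Subsemigroup.coe_set_mk,
    Set.disjoint_compl_left_iff_subset, SetLike.coe_subset_coe]

theorem exists_isPrime_chain_mvPolynomial_atPrime_iff (P : Ideal A) [P.IsPrime] (σ : Type*)
    (n : ℕ) :
    (∃ c : Fin (n + 1) → Ideal (MvPolynomial σ (Localization.AtPrime P)),
        StrictMono c ∧ ∀ i, (c i).IsPrime) ↔
      ∃ c : Fin (n + 1) → Ideal (MvPolynomial σ A), StrictMono c ∧
        ∀ i, (c i).IsPrime ∧ (c i).comap (algebraMap A (MvPolynomial σ A)) ≤ P := by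
  let := MvPolynomial.algebraMvPolynomial (R := A) (S := Localization.AtPrime P) (σ := σ)
  have := MvPolynomial.isLocalization (σ := σ) P.primeCompl (Localization.AtPrime P)
  rw [exists_isPrime_chain_localization_iff (P.primeCompl.map (MvPolynomial.C (σ := σ)))]
  have h (Q : Ideal (MvPolynomial σ A)) :
      Disjoint (P.primeCompl.map (MvPolynomial.C (σ := σ)) : Set (MvPolynomial σ A)) Q ↔
        Q.comap (algebraMap A (MvPolynomial σ A)) ≤ P := by
    rw [Submonoid.coe_map, Set.disjoint_image_left]
    exact Set.disjoint_compl_left_iff_subset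
  simp only [h]

end Dimension

section LocallyJaffard

variable {D F : Type*} [CommRing D] [Field F] [Algebra D F]

theorem quasiPolyPrime_iff [FaithfulSMul D F] (s : SemistarOp D F) {n : ℕ} {Q : Ideal (MvPolynomial (Fin n) D)} :
    QuasiPolyPrime s n Q ↔ Q ≠ ⊥ ∧ Q.IsPrime ∧
      (Q.comap (algebraMap D (MvPolynomial (Fin n) D)) ≠ ⊥ →
        IsQuasiPrime s.tilde (Q.comap (algebraMap D (MvPolynomial (Fin n) D)))) := by
  refine and_congr_right fun _ => and_congr_right fun _ => ?_
  rw [or_iff_not_imp_left]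
  exact forall_congr' fun h => (s.isQuasiPrime_tilde_iff h).symm

theorem IsQuasiPrime.tilde_of_le [FaithfulSMul D F] {s : SemistarOp D F} {P P' : Ideal D} [P'.IsPrime]
    (hP : IsQuasiPrime s.tilde P) (hP' : P' ≠ ⊥) (h : P' ≤ P) : IsQuasiPrime s.tilde P' := by
  have := hP.1
  have hft := (s.isQuasiPrime_tilde_iff hP.2.1).1 hP
  rw [← s.one_notMem_ft_iff hP.2.1] at hft
  rw [s.isQuasiPrime_tilde_iff hP', ← s.one_notMem_ft_iff hP']
  exact fun hone => hft (s.ft_mono (idealExt_mono h) hone)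

theorem krullDimE_atPrime_le_tildeDim [FaithfulSMul D F] {s : SemistarOp D F}
    {P : Ideal D} [P.IsPrime] (hP : P ≠ ⊥ → IsQuasiPrime s.tilde P) :
    krullDimE (Localization.AtPrime P) ≤ tildeDim s := by
  refine iSup₂_le fun m hm => ?_
  obtain ⟨c, hc, hprime⟩ := (exists_isPrime_chain_atPrime_iff P m).1 hm
  refine le_iSup₂_of_le m (DimChainFor.of_isPrime_chain hc fun i hi => ?_) le_rfl
  have := (hprime i).1
  exact (hP (ne_bot_of_le_ne_bot hi (hprime i).2)).tilde_of_le hi (hprime i).2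

theorem krullDimE_mvPolynomial_atPrime_le_polyDim [FaithfulSMul D F] {s : SemistarOp D F}
    {P : Ideal D} [P.IsPrime] (hP : P ≠ ⊥ → IsQuasiPrime s.tilde P) (n : ℕ) :
    krullDimE (MvPolynomial (Fin n) (Localization.AtPrime P)) ≤ polyDim s n := by
  refine iSup₂_le fun m hm => ?_
  obtain ⟨c, hc, hprime⟩ := (exists_isPrime_chain_mvPolynomial_atPrime_iff P (Fin n) m).1 hm
  refine le_iSup₂_of_le m (DimChainFor.of_isPrime_chain hc fun i hi => ?_) le_rfl
  have := (hprime i).1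
  exact (quasiPolyPrime_iff s).2 ⟨hi, this, fun h0 =>
    (hP (ne_bot_of_le_ne_bot h0 (hprime i).2)).tilde_of_le h0 (hprime i).2⟩

theorem exists_le_krullDimE_atPrime_of_dimChainFor [IsDomain D] {s : SemistarOp D F} {m : ℕ}
    (h : DimChainFor (IsQuasiPrime s.tilde) m) :
    ∃ (P : Ideal D) (_ : P.IsPrime), (P ≠ ⊥ → IsQuasiPrime s.tilde P) ∧
      m ≤ krullDimE (Localization.AtPrime P) := by
  obtain ⟨c, hc, h0, hΦ⟩ := h
  have hprime (i) : (c i).IsPrime := by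
    by_cases hi : i = 0
    · exact hi ▸ h0 ▸ Ideal.isPrime_bot
    · exact (hΦ i hi).1
  have := hprime (Fin.last m)
  refine ⟨c (Fin.last m), this, fun hne => hΦ _ fun hlast => hne (hlast ▸ h0), ?_⟩
  exact le_iSup₂_of_le m ((exists_isPrime_chain_atPrime_iff _ m).2
    ⟨c, hc, fun i => ⟨hprime i, hc.monotone i.le_last⟩⟩) le_rfl

theorem exists_le_krullDimE_mvPolynomial_atPrime_of_dimChainFor [IsDomain D] [FaithfulSMul D F]
    {s : SemistarOp D F} {n m : ℕ} (h : DimChainFor (QuasiPolyPrime s n) m) :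
    ∃ (P : Ideal D) (_ : P.IsPrime), (P ≠ ⊥ → IsQuasiPrime s.tilde P) ∧
      m ≤ krullDimE (MvPolynomial (Fin n) (Localization.AtPrime P)) := by
  obtain ⟨c, hc, h0, hΦ⟩ := h
  have hprime (i) : (c i).IsPrime := by
    by_cases hi : i = 0
    · exact hi ▸ h0 ▸ Ideal.isPrime_bot
    · exact (hΦ i hi).2.1
  have := hprime (Fin.last m)
  refine ⟨(c (Fin.last m)).comap (algebraMap D (MvPolynomial (Fin n) D)), inferInstance,
    fun hne => ((quasiPolyPrime_iff s).1 (hΦ _ fun hlast => hne ?_)).2.2 hne, ?_⟩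
  · rw [hlast, h0]
    exact Ideal.comap_bot_of_injective _ (FaithfulSMul.algebraMap_injective _ _)
  · exact le_iSup₂_of_le m ((exists_isPrime_chain_mvPolynomial_atPrime_iff _ (Fin n) m).2
      ⟨c, hc, fun i => ⟨hprime i, Ideal.comap_mono (hc.monotone i.le_last)⟩⟩) le_rfl

theorem krullDimE_mvPolynomial_atPrime_bot [IsDomain D] (n : ℕ) :
    krullDimE (MvPolynomial (Fin n) (Localization.AtPrime (⊥ : Ideal D))) =
      krullDimE (Localization.AtPrime (⊥ : Ideal D)) + n := by
  have : IsFractionRing D (Localization.AtPrime (⊥ : Ideal D)) := by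
    rw [IsFractionRing, ← Ideal.primeCompl_bot]
    infer_instance
  let := IsFractionRing.toField D (K := Localization.AtPrime (⊥ : Ideal D))
  have : IsNoetherianRing (Localization.AtPrime (⊥ : Ideal D)) := inferInstance
  exact krullDimE_mvPolynomial_of_isNoetherianRing n

end LocallyJaffard

/-- If `⋆̃-dim D` is finite and `D` is `⋆̃`-locally Jaffard (i.e. `D_P`
is a Jaffard domain for every quasi-`⋆̃`-prime `P`), then `D` is a `⋆̃`-Jaffard domain. -/
theorem tildeLocallyJaffard_isTildeJaffard (D : Type*) [CommRing D] [IsDomain D]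
    (s : SemistarOp D (FractionRing D)) (hdim : tildeDim s ≠ ⊤)
    (hloc : ∀ (P : Ideal D) [P.IsPrime], IsQuasiIdeal s.tilde P →
      IsJaffardDomain (Localization.AtPrime P)) :
    TildeJaffard s := by
  refine ⟨hdim, fun n hn => ?_⟩
  have key (P : Ideal D) [P.IsPrime] (hP : P ≠ ⊥ → IsQuasiPrime s.tilde P) :
      krullDimE (MvPolynomial (Fin n) (Localization.AtPrime P)) =
        krullDimE (Localization.AtPrime P) + n := by
    by_cases h0 : P = ⊥
    · subst h0
      exact krullDimE_mvPolynomial_atPrime_bot n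
    · exact (hloc P (hP h0).2).2 n hn
  apply le_antisymm
  · refine iSup₂_le fun m hm => ?_
    obtain ⟨P, _, hP, hle⟩ := exists_le_krullDimE_mvPolynomial_atPrime_of_dimChainFor hm
    rw [key P hP] at hle
    exact hle.trans (add_le_add_left (krullDimE_atPrime_le_tildeDim hP) _)
  · have hne : ∃ m, DimChainFor (IsQuasiPrime s.tilde) m :=
      ⟨0, fun _ => ⊥, fun i j hij => by omega, rfl, fun i hi => absurd (by omega) hi⟩
    rw [tildeDim, quasiDim, ENat.biSup_add' hne]
    refine iSup₂_le fun m hm => ?_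
    obtain ⟨P, _, hP, hle⟩ := exists_le_krullDimE_atPrime_of_dimChainFor hm
    calc (m : ℕ∞) + n ≤ krullDimE (Localization.AtPrime P) + n := add_le_add_left hle _
      _ = krullDimE (MvPolynomial (Fin n) (Localization.AtPrime P)) := (key P hP).symm
      _ ≤ polyDim s n := krullDimE_mvPolynomial_atPrime_le_polyDim hP n
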